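/- Let (W, S) be a Coxeter system, S_P ⊆ S a subset, and let w ∈ W^P be a Coxeter-type element. Then the poset [e,w]_{W^P} = {v ∈ W^P : v ≤ w}, ordered by the Bruhat order, is a lattice: every pair of elements of [e,w]_{W^P} has a least upper bound and a greatest lower bound within [e,w]_{W^P}. -/

import Mathlib

/-- The Bruhat order on a Coxeter group, characterized by the subword property:
`u ≤ w` iff every reduced word for `w` contains a subword that is a reduced word for `u`. -/
def CoxeterSystem.bruhatLE {B W : Type*} [Group W] {M : CoxeterMatrix B}
    (cs : CoxeterSystem M W) (u w : W) : Prop :=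
  ∀ ω : List B, cs.IsReduced ω → cs.wordProd ω = w →
    ∃ ω' : List B, ω'.Sublist ω ∧ cs.IsReduced ω' ∧ cs.wordProd ω' = u

/-- The set `W^P` of minimal length coset representatives attached to a subset `S_P` of the
simple reflections: `W^P = {v ∈ W : ℓ(v s) > ℓ(v) for every s ∈ S_P}`. -/
def CoxeterSystem.minCosetReps {B W : Type*} [Group W] {M : CoxeterMatrix B}
    (cs : CoxeterSystem M W) (SP : Set B) : Set W :=
  {v | ∀ i ∈ SP, cs.length v < cs.length (v * cs.simple i)}

/-- The Bruhat interval `[e, w]_{W^P} = {v ∈ W^P : v ≤ w}`. -/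
def CoxeterSystem.intervalWP {B W : Type*} [Group W] {M : CoxeterMatrix B}
    (cs : CoxeterSystem M W) (SP : Set B) (w : W) : Set W :=
  {v | v ∈ cs.minCosetReps SP ∧ cs.bruhatLE v w}

namespace CoxeterSystem

variable {B W : Type*} [Group W] {M : CoxeterMatrix B} (cs : CoxeterSystem M W)

section Exchange

open scoped Classical in
/-- The action of a simple reflection on `W × ZMod 2` that conjugates the first coordinate and
flips the second one at the reflection itself. -/
noncomputable def signedConj (i : B) : Function.End (W × ZMod 2) :=
  fun p ↦ (cs.simple i * p.1 * cs.simple i, p.2 + if p.1 = cs.simple i then 1 else 0)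

open scoped Classical in
theorem prod_map_signedConj_apply (ω : List B) (t : W) (z : ZMod 2) :
    (ω.map cs.signedConj).prod (t, z) =
      (cs.wordProd ω * t * (cs.wordProd ω)⁻¹, z + ((cs.rightInvSeq ω).count t : ℕ)) := by
  induction ω with
  | nil => simp; rfl
  | cons i ω ih =>
    rw [List.map_cons, List.prod_cons]
    change cs.signedConj i ((ω.map cs.signedConj).prod (t, z)) = _
    rw [ih]
    have key : cs.wordProd ω * t * (cs.wordProd ω)⁻¹ = cs.simple i ↔
        (cs.wordProd ω)⁻¹ * cs.simple i * cs.wordProd ω = t := by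
      constructor
      · intro h
        rw [← h]
        group
      · rintro rfl
        group
    simp only [signedConj, rightInvSeq, key, List.count_cons, wordProd_cons, beq_iff_eq]
    refine Prod.ext ?_ ?_
    · simp [mul_assoc]
    · split_ifs <;> simp [add_assoc]

theorem leftInvSeq_alternatingWord_two_mul (i j : B) (p : ℕ) :
    cs.leftInvSeq (alternatingWord i j (2 * p)) =
      (List.range (2 * p)).map fun k ↦ cs.wordProd (alternatingWord j i (2 * k + 1)) := by
  refine List.ext_getElem (by simp) fun k hk _ ↦ ?_
  rw [cs.getElem_leftInvSeq_alternatingWord i j p k (by simpa using hk)]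
  simp

theorem wordProd_alternatingWord_add_period (i j : B) (k : ℕ) :
    cs.wordProd (alternatingWord j i (2 * (M j i + k) + 1)) =
      cs.wordProd (alternatingWord j i (2 * k + 1)) := by
  have h (n : ℕ) : ¬ Even (2 * n + 1) := by simp
  have h' (n : ℕ) : (2 * n + 1) / 2 = n := by lia
  simp only [prod_alternatingWord_eq_mul_pow, h, h', if_false, pow_add, simple_mul_simple_pow,
    one_mul]

theorem prod_map_signedConj_reverse_alternatingWord (i j : B) (m : ℕ) :
    ((alternatingWord j i (2 * m)).reverse.map cs.signedConj).prod =
      (cs.signedConj i * cs.signedConj j) ^ m := by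
  induction m with
  | zero => simp [alternatingWord]
  | succ m ih =>
    rw [show 2 * (m + 1) = 2 * m + 1 + 1 by ring, alternatingWord_succ, alternatingWord_succ,
      pow_succ', ← ih]
    simp [mul_assoc]

open scoped Classical in
theorem isLiftable_signedConj : M.IsLiftable cs.signedConj := by
  intro i j
  rw [← prod_map_signedConj_reverse_alternatingWord]
  funext ⟨t, z⟩
  rw [prod_map_signedConj_apply, rightInvSeq_reverse, leftInvSeq_alternatingWord_two_mul,
    List.count_reverse, two_mul, List.range_add, List.map_append, List.map_map, List.count_append]
  have h : ((fun k ↦ cs.wordProd (alternatingWord i j (2 * k + 1))) ∘ fun x ↦ M i j + x) =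
      fun k ↦ cs.wordProd (alternatingWord i j (2 * k + 1)) :=
    funext fun k ↦ cs.wordProd_alternatingWord_add_period j i k
  rw [h, wordProd_reverse, ← two_mul, prod_alternatingWord_eq_mul_pow]
  have h3 : (cs.simple j * cs.simple i) ^ M i j = 1 := by
    rw [M.symmetric]; exact cs.simple_mul_simple_pow j i
  refine Prod.ext (by simp [h3]; rfl) ?_
  rw [Nat.cast_add, CharTwo.add_self_eq_zero, add_zero]
  rfl

open scoped Classical in
/-- The parity of the number of occurrences of `t` in the left inversion sequence of a word depends
only on the product of the word. -/
theorem count_leftInvSeq_cast_eq {ω ω' : List B} (h : cs.wordProd ω = cs.wordProd ω') (t : W) :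
    (((cs.leftInvSeq ω).count t : ℕ) : ZMod 2) = ((cs.leftInvSeq ω').count t : ℕ) := by
  have hprod (τ : List B) : cs.lift ⟨_, cs.isLiftable_signedConj⟩ (cs.wordProd τ) =
      (τ.map cs.signedConj).prod := by
    rw [wordProd, map_list_prod, List.map_map]
    congr 2
    funext i
    exact cs.lift_apply_simple cs.isLiftable_signedConj i
  have h1 : cs.wordProd ω.reverse = cs.wordProd ω'.reverse := by simp [h]
  have h2 := congrFun ((hprod ω.reverse).symm.trans ((congrArg _ h1).trans (hprod ω'.reverse)))
    (t, 0)
  rw [prod_map_signedConj_apply, prod_map_signedConj_apply] at h2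
  simpa [rightInvSeq_reverse] using congrArg Prod.snd h2

/-- The exchange condition. -/
theorem exists_wordProd_eq_of_isLeftDescent {ω : List B} {i : B}
    (h : cs.IsLeftDescent (cs.wordProd ω) i) :
    ∃ α x β, ω = α ++ x :: β ∧ cs.simple i * cs.wordProd ω = cs.wordProd (α ++ β) := by
  classical
  obtain ⟨τ, hτ, hτω⟩ := cs.exists_isReduced (cs.simple i * cs.wordProd ω)
  have hw : cs.wordProd (i :: τ) = cs.wordProd ω := by
    rw [wordProd_cons, ← hτω, simple_mul_simple_cancel_left]
  have hred : cs.IsReduced (i :: τ) := by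
    rw [isLeftDescent_iff, hτω, hτ.eq] at h
    rw [IsReduced, hw, ← h, List.length_cons]
  have hone : (cs.leftInvSeq (i :: τ)).count (cs.simple i) = 1 :=
    List.count_eq_one_of_mem hred.nodup_leftInvSeq (by simp [leftInvSeq])
  have hpar := cs.count_leftInvSeq_cast_eq hw (cs.simple i)
  have hmem : cs.simple i ∈ cs.leftInvSeq ω := by
    by_contra hn
    rw [hone, List.count_eq_zero_of_not_mem hn] at hpar
    simp at hpar
  obtain ⟨k, hk, hki⟩ := List.getElem_of_mem hmem
  have hk' : k < ω.length := by simpa using hk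
  refine ⟨ω.take k, ω[k], ω.drop (k + 1), by simp, ?_⟩
  rw [← List.eraseIdx_eq_take_drop_succ, ← getD_leftInvSeq_mul_wordProd,
    List.getD_eq_getElem _ _ hk, hki]

end Exchange

section Support

variable {cs}

theorem IsReduced.of_append_left {α β : List B} (h : cs.IsReduced (α ++ β)) : cs.IsReduced α := by
  simpa using h.take α.length

theorem IsReduced.of_append_right {α β : List B} (h : cs.IsReduced (α ++ β)) : cs.IsReduced β := by
  simpa using h.drop α.length

theorem IsReduced.of_cons {i : B} {β : List B} (h : cs.IsReduced (i :: β)) : cs.IsReduced β :=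
  IsReduced.of_append_right (α := [i]) h

theorem IsReduced.isLeftDescent {i : B} {β : List B} (h : cs.IsReduced (i :: β)) :
    cs.IsLeftDescent (cs.wordProd (i :: β)) i := by
  rw [isLeftDescent_iff, h.eq, wordProd_cons, simple_mul_simple_cancel_left, h.of_cons.eq,
    List.length_cons]

theorem IsReduced.of_wordProd_eq {ω ω' : List B} (h : cs.IsReduced ω)
    (hp : cs.wordProd ω = cs.wordProd ω') (hl : ω'.length = ω.length) : cs.IsReduced ω' := by
  rw [IsReduced, ← hp, h.eq, hl]

theorem IsReduced.length_eq {ω ω' : List B} (h : cs.IsReduced ω) (h' : cs.IsReduced ω')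
    (hp : cs.wordProd ω = cs.wordProd ω') : ω.length = ω'.length := by
  rw [← h.eq, ← h'.eq, hp]

/-- Reduced words for the same element involve the same simple reflections. -/
theorem IsReduced.map_simple_subset {ω ω' : List B} (h : cs.IsReduced ω) (h' : cs.IsReduced ω')
    (hp : cs.wordProd ω = cs.wordProd ω') : ω.map cs.simple ⊆ ω'.map cs.simple := by
  induction hn : ω.length using Nat.strong_induction_on generalizing ω ω' with
  | _ n ih =>
  subst hn
  rcases ω with _ | ⟨i, τ⟩
  · simp
  have hlen := h.length_eq h' hp
  obtain ⟨α, x, β, rfl, hx⟩ := cs.exists_wordProd_eq_of_isLeftDescent (hp ▸ h.isLeftDescent)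
  simp only [List.length_append, List.length_cons] at hlen
  rw [← hp, wordProd_cons, simple_mul_simple_cancel_left] at hx
  have hαβ : cs.IsReduced (α ++ β) := h.of_cons.of_wordProd_eq hx (by simp; lia)
  have htail : τ.map cs.simple ⊆ (α ++ x :: β).map cs.simple :=
    List.Subset.trans (ih _ (by simp) h.of_cons hαβ hx rfl) (by simp)
  rw [List.map_cons, List.cons_subset]
  refine ⟨?_, htail⟩
  have hcomm : cs.wordProd (i :: α) = cs.wordProd (α ++ [x]) := by
    rw [wordProd_cons, hx] at hp
    simp only [wordProd_append, wordProd_cons, ← mul_assoc] at hp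
    simpa [wordProd_append, wordProd_cons] using hp
  have hαx : cs.IsReduced (α ++ [x]) :=
    IsReduced.of_append_left (β := β) (by simpa using h')
  have hiα : cs.IsReduced (i :: α) := hαx.of_wordProd_eq hcomm.symm (by simp)
  suffices cs.simple i ∈ (α ++ [x]).map cs.simple by
    simp only [List.map_append, List.mem_append, List.map_cons, List.mem_cons] at this ⊢
    tauto
  by_cases hβ : β = []
  swap
  · have := List.length_pos_of_ne_nil hβ
    exact ih (i :: α).length (by simp; lia) hiα hαx hcomm rfl (by simp)
  subst hβ
  rcases α with _ | ⟨y, α⟩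
  · simp only [wordProd_cons, List.nil_append] at hcomm
    simpa using hcomm
  have hdesc : cs.IsLeftDescent (cs.wordProd (i :: y :: α)) y := by
    rw [hcomm]; exact hαx.isLeftDescent
  have hαx' : cs.IsReduced (α ++ [x]) := hαx.of_cons
  have hstep : cs.simple y * cs.wordProd (i :: y :: α) = cs.wordProd (α ++ [x]) := by
    rw [hcomm, List.cons_append, wordProd_cons, simple_mul_simple_cancel_left]
  obtain ⟨γ, z, δ, hγ, hz⟩ := cs.exists_wordProd_eq_of_isLeftDescent hdesc
  rcases γ with _ | ⟨j, γ⟩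
  · simp only [List.nil_append, List.cons.injEq] at hγ
    obtain ⟨rfl, rfl⟩ := hγ
    rw [List.nil_append, wordProd_cons _ y, mul_right_inj] at hz
    have h1 := hiα.eq
    have h2 := cs.length_wordProd_le α
    rw [hz] at h1
    simp at h1
    lia
  · simp only [List.cons_append, List.cons.injEq] at hγ
    obtain ⟨rfl, hγ⟩ := hγ
    have hl := congrArg List.length hγ
    simp only [List.length_append, List.length_cons] at hl
    have hprod := hstep.symm.trans hz
    have hr : cs.IsReduced (i :: γ ++ δ) := hαx'.of_wordProd_eq hprod (by simp; lia)
    have := ih (i :: γ ++ δ).length (by simp at hlen ⊢; lia) hr hαx' hprod.symm rfl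
      (List.mem_map_of_mem (a := i) (by simp))
    simp only [List.cons_append, List.map_cons, List.mem_cons]
    exact Or.inr this

end Support

section Distinct

variable {cs}

/-- A word in pairwise distinct simple reflections is reduced. -/
theorem isReduced_of_nodup {ω : List B} (h : (ω.map cs.simple).Nodup) : cs.IsReduced ω := by
  induction ω with
  | nil => simp [IsReduced]
  | cons i τ ih =>
    rw [List.map_cons, List.nodup_cons] at h
    have hτ := ih h.2
    by_cases hd : cs.IsLeftDescent (cs.wordProd τ) i
    · obtain ⟨α, x, β, rfl, hx⟩ := cs.exists_wordProd_eq_of_isLeftDescent hd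
      have hp : cs.wordProd (α ++ x :: β) = cs.wordProd (i :: (α ++ β)) := by
        rw [wordProd_cons, ← hx, simple_mul_simple_cancel_left]
      have hr := hτ.of_wordProd_eq hp (by simp; lia)
      exact absurd (hr.map_simple_subset hτ hp.symm (by simp)) h.1
    · rw [not_isLeftDescent_iff, hτ.eq] at hd
      rw [IsReduced, wordProd_cons, hd, List.length_cons]

theorem exists_mul_wordProd_eq_of_isLeftDescent {ω : List B} (h : (ω.map cs.simple).Nodup) {i : B}
    (hi : cs.IsLeftDescent (cs.wordProd ω) i) :
    ∃ α x β, ω = α ++ x :: β ∧ cs.simple x = cs.simple i ∧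
      cs.simple i * cs.wordProd α = cs.wordProd α * cs.simple i := by
  have hred := isReduced_of_nodup h
  obtain ⟨α, x, β, rfl, hx⟩ := cs.exists_wordProd_eq_of_isLeftDescent hi
  have hp : cs.wordProd (α ++ x :: β) = cs.wordProd (i :: (α ++ β)) := by
    rw [wordProd_cons, ← hx, simple_mul_simple_cancel_left]
  have hr := hred.of_wordProd_eq hp (by simp; lia)
  have hmem : cs.simple x ∈ (i :: (α ++ β)).map cs.simple :=
    hred.map_simple_subset hr hp (by simp)
  have hxi : cs.simple x = cs.simple i := by
    rw [List.map_append, List.map_cons, List.nodup_middle, List.nodup_cons] at h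
    rw [List.map_cons, List.mem_cons, List.map_append] at hmem
    exact hmem.resolve_right h.1
  refine ⟨α, x, β, rfl, hxi, ?_⟩
  simp only [wordProd_append, wordProd_cons, ← mul_assoc, mul_left_inj, hxi] at hp
  exact hp.symm

theorem commute_of_commute_wordProd {α : List B} {i : B} (h : ((i :: α).map cs.simple).Nodup)
    (hc : Commute (cs.simple i) (cs.wordProd α)) :
    ∀ j ∈ α, Commute (cs.simple i) (cs.simple j) := by
  induction α with
  | nil => simp
  | cons y α ih =>
    have hperm : ((y :: (α ++ [i])).map cs.simple).Nodup := by
      refine (List.Perm.nodup_iff (List.Perm.map _ ?_)).mp h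
      exact (List.Perm.swap y i α).trans ((List.perm_append_singleton i α).symm.cons y)
    have hp : cs.wordProd (i :: y :: α) = cs.wordProd (y :: (α ++ [i])) := by
      rw [wordProd_cons, hc.eq]
      simp [wordProd_cons, wordProd_append, mul_assoc]
    have hd : cs.IsLeftDescent (cs.wordProd (i :: y :: α)) y := by
      rw [hp]; exact (isReduced_of_nodup hperm).isLeftDescent
    obtain ⟨γ, x, δ, hγ, hxy, hcomm⟩ := exists_mul_wordProd_eq_of_isLeftDescent h hd
    have hiy : Commute (cs.simple i) (cs.simple y) := by
      simp only [List.map_cons, List.nodup_cons, List.mem_cons, not_or] at h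
      rcases γ with _ | ⟨a, _ | ⟨b, γ⟩⟩
      · simp only [List.nil_append, List.cons.injEq] at hγ
        exact absurd (hγ.1 ▸ hxy) h.1.1
      · simp only [List.cons_append, List.cons.injEq] at hγ
        rw [← hγ.1, wordProd_singleton] at hcomm
        exact hcomm.symm
      · simp only [List.cons_append, List.cons.injEq] at hγ
        refine absurd ?_ h.2.1
        rw [← hxy, hγ.2.2]
        simp
    have hiα : Commute (cs.simple i) (cs.wordProd α) := by
      have := hiy.mul_right hc
      rwa [wordProd_cons, simple_mul_simple_cancel_left] at this
    have hnd : ((i :: α).map cs.simple).Nodup :=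
      h.sublist (((List.sublist_cons_self y α).cons_cons i).map _)
    simpa [hiy] using ih hnd hiα

theorem exists_commute_of_isLeftDescent {ω : List B} (h : (ω.map cs.simple).Nodup) {i : B}
    (hi : cs.IsLeftDescent (cs.wordProd ω) i) :
    ∃ α x β, ω = α ++ x :: β ∧ cs.simple x = cs.simple i ∧
      ∀ j ∈ α, Commute (cs.simple i) (cs.simple j) := by
  obtain ⟨α, x, β, rfl, hxi, hc⟩ := exists_mul_wordProd_eq_of_isLeftDescent h hi
  refine ⟨α, x, β, rfl, hxi, commute_of_commute_wordProd ?_ hc⟩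
  rw [List.map_append, List.map_cons, List.nodup_middle, hxi, ← List.map_append,
    ← List.map_cons] at h
  exact h.sublist (((List.sublist_append_left α β).cons_cons i).map _)

theorem exists_commute_of_isRightDescent {ω : List B} (h : (ω.map cs.simple).Nodup) {i : B}
    (hi : cs.IsRightDescent (cs.wordProd ω) i) :
    ∃ α x β, ω = α ++ x :: β ∧ cs.simple x = cs.simple i ∧
      ∀ j ∈ β, Commute (cs.simple i) (cs.simple j) := by
  rw [← isLeftDescent_inv_iff, ← wordProd_reverse] at hi
  obtain ⟨α, x, β, hω, hxi, hc⟩ := exists_commute_of_isLeftDescent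
    (by rwa [List.map_reverse, List.nodup_reverse]) hi
  refine ⟨β.reverse, x, α.reverse, ?_, hxi, by simpa using hc⟩
  rw [← ω.reverse_reverse, hω]
  simp

theorem IsReduced.map_simple_perm {ω ω' : List B} (h : (ω.map cs.simple).Nodup)
    (h' : cs.IsReduced ω') (hp : cs.wordProd ω = cs.wordProd ω') :
    (ω.map cs.simple).Perm (ω'.map cs.simple) := by
  have hr := isReduced_of_nodup h
  refine (List.subperm_of_subset h (hr.map_simple_subset h' hp)).perm_of_length_le ?_
  simp [hr.length_eq h' hp]

variable (cs) in
open scoped Classical in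
/-- The subword of `ω` formed by the letters whose simple reflection lies in `J`. -/
noncomputable def subword (ω : List B) (J : Set W) : List B :=
  ω.filter fun i ↦ cs.simple i ∈ J

variable (ω : List B) (J : Set W)

theorem subword_sublist : (cs.subword ω J).Sublist ω := List.filter_sublist

theorem nodup_subword {ω : List B} (h : (ω.map cs.simple).Nodup) (J : Set W) :
    ((cs.subword ω J).map cs.simple).Nodup :=
  h.sublist ((subword_sublist ω J).map _)

theorem mem_map_subword {ω : List B} {J : Set W} {t : W} :
    t ∈ (cs.subword ω J).map cs.simple ↔ t ∈ ω.map cs.simple ∧ t ∈ J := by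
  simp only [subword, List.mem_map, List.mem_filter, decide_eq_true_eq]
  constructor
  · rintro ⟨i, ⟨hi, hJ⟩, rfl⟩
    exact ⟨⟨i, hi, rfl⟩, hJ⟩
  · rintro ⟨⟨i, hi, rfl⟩, hJ⟩
    exact ⟨i, ⟨hi, hJ⟩, rfl⟩

theorem subword_append (ω' : List B) :
    cs.subword (ω ++ ω') J = cs.subword ω J ++ cs.subword ω' J := by
  simp [subword]

theorem subword_cons_of_mem {i : B} (hi : cs.simple i ∈ J) :
    cs.subword (i :: ω) J = i :: cs.subword ω J := by
  simp [subword, hi]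

theorem subword_cons_of_notMem {i : B} (hi : cs.simple i ∉ J) :
    cs.subword (i :: ω) J = cs.subword ω J := by
  simp [subword, hi]

theorem commute_wordProd {ω : List B} {w : W} (h : ∀ j ∈ ω, Commute w (cs.simple j)) :
    Commute w (cs.wordProd ω) :=
  Commute.list_prod_right _ _ (by simpa using h)

theorem commute_wordProd_subword {ω : List B} {w : W} (h : ∀ j ∈ ω, Commute w (cs.simple j))
    (J : Set W) : Commute w (cs.wordProd (cs.subword ω J)) :=
  commute_wordProd fun j hj ↦ h j ((subword_sublist ω J).subset hj)

theorem subword_subword {J K : Set W} (h : J ⊆ K) :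
    cs.subword (cs.subword ω K) J = cs.subword ω J := by
  simp only [subword, List.filter_filter]
  refine List.filter_congr fun i _ ↦ ?_
  simpa using fun hi ↦ h hi

theorem subword_eq_of_sublist {ω ω' : List B} (h : (ω.map cs.simple).Nodup) (hs : ω'.Sublist ω) :
    cs.subword ω {t | t ∈ ω'.map cs.simple} = ω' := by
  induction hs with
  | slnil => rfl
  | @cons l₁ l₂ a hs ih =>
    rw [List.map_cons, List.nodup_cons] at h
    rw [subword_cons_of_notMem _ _ fun ha ↦ h.1 ((hs.map _).subset ha), ih h.2]
  | @cons_cons l₁ l₂ a hs ih =>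
    rw [List.map_cons, List.nodup_cons] at h
    rw [subword_cons_of_mem _ _ (by simp)]
    congr 1
    refine Eq.trans ?_ (ih h.2)
    refine List.filter_congr fun i hi ↦ ?_
    have hne : cs.simple i ≠ cs.simple a := fun e ↦ h.1 (e ▸ List.mem_map_of_mem hi)
    simp [hne]

/-- Selecting letters from the reduced words of a Coxeter-type element gives a product that does
not depend on the reduced word. -/
theorem wordProd_subword_eq {ω ω' : List B} (h : (ω.map cs.simple).Nodup) (h' : cs.IsReduced ω')
    (hp : cs.wordProd ω = cs.wordProd ω') (J : Set W) :
    cs.wordProd (cs.subword ω J) = cs.wordProd (cs.subword ω' J) := by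
  induction ω generalizing ω' with
  | nil =>
    have := (isReduced_of_nodup h).length_eq h' hp
    rw [List.eq_nil_of_length_eq_zero this.symm]
  | cons i τ ih =>
    have hr := isReduced_of_nodup h
    have hnd' := (IsReduced.map_simple_perm h h' hp).nodup_iff.mp h
    obtain ⟨α, x, β, rfl, hxi, hc⟩ :=
      exists_commute_of_isLeftDescent hnd' (hp ▸ hr.isLeftDescent)
    have hτ : cs.wordProd τ = cs.wordProd (α ++ β) := by
      rw [wordProd_cons, wordProd_append, wordProd_cons, hxi, ← mul_assoc,
        ← (commute_wordProd hc).eq, mul_assoc, mul_right_inj] at hp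
      rw [hp, wordProd_append]
    have hαβ : ((α ++ β).map cs.simple).Nodup :=
      hnd'.sublist (((List.sublist_cons_self x β).append_left α).map _)
    have hIH := ih (List.nodup_cons.mp h).2 (isReduced_of_nodup hαβ) hτ
    rw [subword_append, wordProd_append] at hIH ⊢
    by_cases hJ : cs.simple i ∈ J
    · rw [subword_cons_of_mem _ _ hJ, subword_cons_of_mem _ _ (hxi ▸ hJ), wordProd_cons,
        wordProd_cons, hIH, hxi, ← mul_assoc, (commute_wordProd_subword hc J).eq, mul_assoc]
    · rw [subword_cons_of_notMem _ _ hJ, subword_cons_of_notMem _ _ (hxi ▸ hJ), hIH]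

theorem bruhatLE_wordProd_iff {ω : List B} (h : (ω.map cs.simple).Nodup) {v : W} :
    cs.bruhatLE v (cs.wordProd ω) ↔
      ∃ J ⊆ {t | t ∈ ω.map cs.simple}, cs.wordProd (cs.subword ω J) = v := by
  constructor
  · intro hv
    obtain ⟨ω', hs, -, rfl⟩ := hv ω (isReduced_of_nodup h) rfl
    exact ⟨{t | t ∈ ω'.map cs.simple}, fun t ht ↦ (hs.map _).subset ht,
      by rw [subword_eq_of_sublist h hs]⟩
  · rintro ⟨J, -, rfl⟩ ω' hr hp
    refine ⟨cs.subword ω' J, subword_sublist ω' J, isReduced_of_nodup (nodup_subword ?_ J),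
      (wordProd_subword_eq h hr hp.symm J).symm⟩
    exact (IsReduced.map_simple_perm h hr hp.symm).nodup_iff.mp h

theorem bruhatLE_wordProd_subword_iff {ω : List B} (h : (ω.map cs.simple).Nodup) {J K : Set W}
    (hJ : J ⊆ {t | t ∈ ω.map cs.simple}) :
    cs.bruhatLE (cs.wordProd (cs.subword ω J)) (cs.wordProd (cs.subword ω K)) ↔ J ⊆ K := by
  rw [bruhatLE_wordProd_iff (nodup_subword h K)]
  constructor
  · rintro ⟨L, -, hL⟩ t ht
    have := (isReduced_of_nodup (nodup_subword h J)).map_simple_subset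
      (isReduced_of_nodup (nodup_subword (nodup_subword h K) L)) hL.symm
      (mem_map_subword.mpr ⟨hJ ht, ht⟩)
    exact (mem_map_subword.mp (mem_map_subword.mp this).1).2
  · intro hJK
    exact ⟨J, fun t ht ↦ mem_map_subword.mpr ⟨hJ ht, hJK ht⟩, by rw [subword_subword ω hJK]⟩

theorem mem_minCosetReps_iff {SP : Set B} {v : W} :
    v ∈ cs.minCosetReps SP ↔ ∀ i ∈ SP, ¬ cs.IsRightDescent v i := by
  refine forall₂_congr fun i _ ↦ ?_
  have := cs.length_mul_simple_ne v i
  rw [IsRightDescent]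
  lia

theorem wordProd_subword_sUnion_mem_minCosetReps {ω : List B} (h : (ω.map cs.simple).Nodup)
    {SP : Set B} {F : Set (Set W)}
    (hF : ∀ J ∈ F, cs.wordProd (cs.subword ω J) ∈ cs.minCosetReps SP) :
    cs.wordProd (cs.subword ω (⋃₀ F)) ∈ cs.minCosetReps SP := by
  rw [mem_minCosetReps_iff]
  intro i hi hd
  obtain ⟨α, x, β, hω, hxi, hc⟩ := exists_commute_of_isRightDescent (nodup_subword h _) hd
  have hx : cs.simple x ∈ (cs.subword ω (⋃₀ F)).map cs.simple := by
    rw [hω]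
    simp
  obtain ⟨J, hJF, hxJ⟩ := (mem_map_subword.mp hx).2
  refine mem_minCosetReps_iff.mp (hF J hJF) i hi ?_
  have hJ : cs.subword ω J = cs.subword α J ++ x :: cs.subword β J := by
    rw [← subword_subword ω (Set.subset_sUnion_of_mem hJF), hω, subword_append,
      subword_cons_of_mem _ _ hxJ]
  have hmul : cs.wordProd (cs.subword ω J) * cs.simple i =
      cs.wordProd (cs.subword α J ++ cs.subword β J) := by
    rw [hJ, wordProd_append, wordProd_append, wordProd_cons, hxi,
      (commute_wordProd_subword hc J).eq, mul_assoc, simple_mul_simple_cancel_right]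
  have hle := cs.length_wordProd_le (cs.subword α J ++ cs.subword β J)
  have heq := (isReduced_of_nodup (nodup_subword h J)).eq
  have hlen := congrArg List.length hJ
  rw [List.length_append, List.length_cons] at hlen
  rw [List.length_append] at hle
  rw [IsRightDescent, hmul]
  lia

end Distinct

end CoxeterSystem

/-- Let `w ∈ W^P` be a Coxeter-type element. Then the poset
`[e, w]_{W^P}` with the Bruhat order is a lattice: every pair of elements has a least upper
bound and a greatest lower bound within `[e, w]_{W^P}`. -/
theorem intervalWP_lattice {B W : Type*} [Group W] {M : CoxeterMatrix B}
    (cs : CoxeterSystem M W) (SP : Set B) (w : W) (hw : w ∈ cs.minCosetReps SP)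
    (hcox : ∃ ω : List B, cs.IsReduced ω ∧ cs.wordProd ω = w ∧ (ω.map cs.simple).Nodup) :
    ∀ a ∈ cs.intervalWP SP w, ∀ b ∈ cs.intervalWP SP w,
      (∃ m ∈ cs.intervalWP SP w, cs.bruhatLE a m ∧ cs.bruhatLE b m ∧
        ∀ c ∈ cs.intervalWP SP w, cs.bruhatLE a c → cs.bruhatLE b c → cs.bruhatLE m c) ∧
      (∃ m ∈ cs.intervalWP SP w, cs.bruhatLE m a ∧ cs.bruhatLE m b ∧
        ∀ c ∈ cs.intervalWP SP w, cs.bruhatLE c a → cs.bruhatLE c b → cs.bruhatLE c m) := by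
  obtain ⟨ω, -, rfl, hω⟩ := hcox
  rintro a ⟨haP, ha⟩ b ⟨hbP, hb⟩
  obtain ⟨J, hJ, rfl⟩ := (CoxeterSystem.bruhatLE_wordProd_iff hω).mp ha
  obtain ⟨K, hK, rfl⟩ := (CoxeterSystem.bruhatLE_wordProd_iff hω).mp hb
  constructor
  · have hJK : ⋃₀ {J, K} ⊆ {t | t ∈ ω.map cs.simple} := by
      simp only [Set.sUnion_pair, Set.union_subset_iff]
      exact ⟨hJ, hK⟩
    refine ⟨cs.wordProd (cs.subword ω (⋃₀ {J, K})),
      ⟨CoxeterSystem.wordProd_subword_sUnion_mem_minCosetReps hω (by simp [haP, hbP]),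
        (CoxeterSystem.bruhatLE_wordProd_iff hω).mpr ⟨_, hJK, rfl⟩⟩,
      (CoxeterSystem.bruhatLE_wordProd_subword_iff hω hJ).mpr (by simp),
      (CoxeterSystem.bruhatLE_wordProd_subword_iff hω hK).mpr (by simp), ?_⟩
    rintro c ⟨-, hc⟩ hac hbc
    obtain ⟨L, -, rfl⟩ := (CoxeterSystem.bruhatLE_wordProd_iff hω).mp hc
    rw [CoxeterSystem.bruhatLE_wordProd_subword_iff hω hJ] at hac
    rw [CoxeterSystem.bruhatLE_wordProd_subword_iff hω hK] at hbc
    rw [CoxeterSystem.bruhatLE_wordProd_subword_iff hω hJK]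
    simp [hac, hbc]
  · set F : Set (Set W) := {L | L ⊆ J ∩ K ∧ cs.wordProd (cs.subword ω L) ∈ cs.minCosetReps SP}
    have hF : ⋃₀ F ⊆ J ∩ K := Set.sUnion_subset fun L hL ↦ hL.1
    have hFω : ⋃₀ F ⊆ {t | t ∈ ω.map cs.simple} := fun t ht ↦ hJ (hF ht).1
    refine ⟨cs.wordProd (cs.subword ω (⋃₀ F)),
      ⟨CoxeterSystem.wordProd_subword_sUnion_mem_minCosetReps hω fun L hL ↦ hL.2,
        (CoxeterSystem.bruhatLE_wordProd_iff hω).mpr ⟨_, hFω, rfl⟩⟩,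
      (CoxeterSystem.bruhatLE_wordProd_subword_iff hω hFω).mpr fun t ht ↦ (hF ht).1,
      (CoxeterSystem.bruhatLE_wordProd_subword_iff hω hFω).mpr fun t ht ↦ (hF ht).2, ?_⟩
    rintro c ⟨hcP, hc⟩ hca hcb
    obtain ⟨L, hL, rfl⟩ := (CoxeterSystem.bruhatLE_wordProd_iff hω).mp hc
    rw [CoxeterSystem.bruhatLE_wordProd_subword_iff hω hL] at hca hcb ⊢
    exact Set.subset_sUnion_of_mem ⟨Set.subset_inter hca hcb, hcP⟩
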